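/- For every m, n ≥ 1 there exists a polynomial c_{m,n} with integer coefficients, in the commuting variables X_d indexed by the proper divisors d of m and Y_e indexed by the proper divisors e of n, such that in the ℚ-algebra B(ℚ) one has [y_n, x_m] = c_{m,n}((x_d)_{d∣m, d≠m}, (y_e)_{e∣n, e≠n}). Moreover c_{1,1} = 1, and c_{m,n} is uniquely determined by this property. -/

import Mathlib

noncomputable section

/-- The product `∏ i, x i ^ e i` over the support of `e`, with factors multiplied in
increasing order of the index. -/
def ordProd {σ M : Type*} [LinearOrder σ] [Monoid M] (x : σ → M) (e : σ →₀ ℕ) : M :=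
  ((e.support.sort (· ≤ ·)).map fun i => x i ^ e i).prod

/-- Evaluation of a multivariate polynomial in a (possibly noncommutative) algebra:
each monomial is evaluated as the ordered product of the powers of the substituted
values, the variables being multiplied in increasing order of their (linearly ordered)
index. -/
def pEval {σ R A : Type*} [LinearOrder σ] [CommSemiring R] [Semiring A] [Algebra R A]
    (x : σ → A) (q : MvPolynomial σ R) : A :=
  q.support.sum fun e => MvPolynomial.coeff e q • ordProd x e

/-- Evaluation of an integral polynomial in the commuting variables `X_d` (`d : ℕ+`, left
summand) and `Y_e` (`e : ℕ+`, right summand), substituting `x d` for `X_d` and `y e` for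
`Y_e`; in each monomial all `X`-factors (in increasing index order) are multiplied to the
left of all `Y`-factors (in increasing index order), as appropriate for a polynomial in
`ℤ[X][Y]`. -/
def cEval {A : Type*} [Ring A] (x y : ℕ+ → A) (q : MvPolynomial (ℕ+ ⊕ₗ ℕ+) ℤ) : A :=
  pEval (fun v => Sum.elim x y (ofLex v)) q

/-- The `k`-th ghost value `w_k(g) = ∑_{d ∣ k} d · (g d)^(k/d)`. -/
def ghost {A : Type*} [Ring A] (g : ℕ+ → A) (k : ℕ+) : A :=
  ∑ d ∈ (k : ℕ).divisors.attach,
    ((d : ℕ) : A) * g ⟨(d : ℕ), Nat.pos_of_mem_divisors d.2⟩ ^ ((k : ℕ) / (d : ℕ))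

/-- The generator `x_d` of the free algebra underlying `B(ℚ)`. -/
def bXf (d : ℕ+) : FreeAlgebra ℚ (ℕ+ ⊕ ℕ+) := FreeAlgebra.ι ℚ (Sum.inl d)

/-- The generator `y_e` of the free algebra underlying `B(ℚ)`. -/
def bYf (e : ℕ+) : FreeAlgebra ℚ (ℕ+ ⊕ ℕ+) := FreeAlgebra.ι ℚ (Sum.inr e)

/-- The defining relations of `B(ℚ)`: `[w_k(x), w_l(x)] = 0`, `[w_k(y), w_l(y)] = 0` and
`[w_l(y), w_k(x)] = δ_{k,l}·k` for all `k, l ≥ 1`. -/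
inductive BRel : FreeAlgebra ℚ (ℕ+ ⊕ ℕ+) → FreeAlgebra ℚ (ℕ+ ⊕ ℕ+) → Prop
  | xx (k l : ℕ+) : BRel (ghost bXf k * ghost bXf l) (ghost bXf l * ghost bXf k)
  | yy (k l : ℕ+) : BRel (ghost bYf k * ghost bYf l) (ghost bYf l * ghost bYf k)
  | yx (k l : ℕ+) : BRel (ghost bYf l * ghost bXf k)
      (ghost bXf k * ghost bYf l + if k = l then ((k : ℕ) : FreeAlgebra ℚ (ℕ+ ⊕ ℕ+)) else 0)

/-- The universal algebra `B(ℚ)`. -/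
abbrev BQ : Type := RingQuot BRel

/-- The generator `x_d` of `B(ℚ)`. -/
def bx (d : ℕ+) : BQ := RingQuot.mkAlgHom ℚ BRel (bXf d)

/-- The generator `y_e` of `B(ℚ)`. -/
def by' (e : ℕ+) : BQ := RingQuot.mkAlgHom ℚ BRel (bYf e)

/-- `c` is a family of polynomials `c_{m,n}` as in the paper: `c m n` is an integral
polynomial in the variables `X_d` (`d` a proper divisor of `m`) and `Y_e` (`e` a proper
divisor of `n`) such that `[y_n, x_m] = c_{m,n}(x, y)` holds in `B(ℚ)`. -/
def IsCFamily (c : ℕ+ → ℕ+ → MvPolynomial (ℕ+ ⊕ₗ ℕ+) ℤ) : Prop :=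
  ∀ m n : ℕ+,
    (∀ v ∈ (c m n).vars,
      (∃ d : ℕ+, (d : ℕ) ∣ (m : ℕ) ∧ d ≠ m ∧ ofLex v = Sum.inl d) ∨
      (∃ e : ℕ+, (e : ℕ) ∣ (n : ℕ) ∧ e ≠ n ∧ ofLex v = Sum.inr e)) ∧
    cEval bx by' (c m n) = by' n * bx m - bx m * by' n

section Ghost

variable {A : Type*} [Ring A]

lemma ghost_eq_sum_divisors (g : ℕ+ → A) (k : ℕ+) :
    ghost g k = ∑ d ∈ (k : ℕ).divisors, (d : A) * g d.toPNat' ^ ((k : ℕ) / d) := by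
  rw [← Finset.sum_attach (k : ℕ).divisors, ghost]
  refine Finset.sum_congr rfl fun d _ => ?_
  have h : (⟨(d : ℕ), Nat.pos_of_mem_divisors d.2⟩ : ℕ+) = (d : ℕ).toPNat' :=
    PNat.eq (by simp [Nat.toPNat'_coe, Nat.pos_of_mem_divisors d.2])
  rw [h]

lemma ghost_eq_properDivisors (g : ℕ+ → A) (k : ℕ+) :
    ghost g k = ∑ d ∈ (k : ℕ).properDivisors, (d : A) * g d.toPNat' ^ ((k : ℕ) / d)
      + (k : A) * g k := by
  rw [ghost_eq_sum_divisors, ← Nat.cons_self_properDivisors k.ne_zero, Finset.sum_cons,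
    add_comm]
  simp [Nat.div_self k.pos]

lemma map_ghost {A' : Type*} [Ring A'] {F : Type*} [FunLike F A A'] [RingHomClass F A A']
    (f : F) (g : ℕ+ → A) (k : ℕ+) : f (ghost g k) = ghost (fun d => f (g d)) k := by
  simp [ghost, map_sum, map_mul, map_pow]

lemma ghost_one (g : ℕ+ → A) : ghost g 1 = g 1 := by
  simp [ghost_eq_properDivisors]

lemma toPNat'_lt_of_mem_properDivisors {d : ℕ} {k : ℕ+} (h : d ∈ (k : ℕ).properDivisors) :
    d.toPNat' < k := by
  rw [← PNat.coe_lt_coe, Nat.toPNat'_coe, if_pos (Nat.pos_of_mem_properDivisors h)]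
  exact (Nat.mem_properDivisors.1 h).2

variable [Algebra ℚ A]

lemma natCast_mul_eq_smul (n : ℕ) (a : A) : (n : A) * a = (n : ℚ) • a := by
  rw [Algebra.smul_def, map_natCast]

lemma natCast_mul_injective {n : ℕ} (hn : n ≠ 0) {a b : A} (h : (n : A) * a = (n : A) * b) :
    a = b := by
  rw [natCast_mul_eq_smul, natCast_mul_eq_smul] at h
  simpa [smul_smul, hn] using congrArg (fun t => (n : ℚ)⁻¹ • t) h

lemma ghost_injective {f g : ℕ+ → A} (h : ∀ k, ghost f k = ghost g k) (k : ℕ+) : f k = g k := by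
  induction k using PNat.strongInductionOn with
  | _ k ih =>
    have hk := h k
    rw [ghost_eq_properDivisors, ghost_eq_properDivisors, Finset.sum_congr rfl fun d hd => by
      rw [ih _ (toPNat'_lt_of_mem_properDivisors hd)]] at hk
    exact natCast_mul_injective k.ne_zero (add_left_cancel hk)

/-- The family with prescribed ghost values. -/
def ghostInv (w : ℕ+ → A) (k : ℕ+) : A :=
  (k : ℚ)⁻¹ • (w k - ∑ d ∈ (k : ℕ).properDivisors.attach,
    ((d : ℕ) : A) * ghostInv w (d : ℕ).toPNat' ^ ((k : ℕ) / (d : ℕ)))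
termination_by k
decreasing_by exact toPNat'_lt_of_mem_properDivisors d.2

lemma ghost_ghostInv (w : ℕ+ → A) (k : ℕ+) : ghost (ghostInv w) k = w k := by
  rw [ghost_eq_properDivisors, natCast_mul_eq_smul, ghostInv, smul_inv_smul₀ (by simp),
    Finset.sum_attach (k : ℕ).properDivisors
      (fun d => (d : A) * ghostInv w d.toPNat' ^ ((k : ℕ) / d))]
  abel

/-- `D` contains the divisors of each of its elements. -/
def IsDivClosed (D : Set ℕ+) : Prop := ∀ k ∈ D, ∀ d : ℕ+, (d : ℕ) ∣ k → d ∈ D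

lemma toPNat'_mem {D : Set ℕ+} (hD : IsDivClosed D) {k : ℕ+} (hk : k ∈ D) {d : ℕ}
    (h : d ∈ (k : ℕ).divisors) : d.toPNat' ∈ D := by
  refine hD k hk _ ?_
  rw [Nat.toPNat'_coe, if_pos (Nat.pos_of_mem_divisors h)]
  exact Nat.dvd_of_mem_divisors h

lemma ghost_mem_adjoin (g : ℕ+ → A) {D : Set ℕ+} (hD : IsDivClosed D) {k : ℕ+} (hk : k ∈ D) :
    ghost g k ∈ Algebra.adjoin ℚ (g '' D) := by
  rw [ghost_eq_sum_divisors]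
  refine sum_mem fun d hd => mul_mem (natCast_mem _ _) (pow_mem ?_ _)
  exact Algebra.subset_adjoin (Set.mem_image_of_mem g (toPNat'_mem hD hk hd))

lemma properDivisors_sum_mem_adjoin (g : ℕ+ → A) {D : Set ℕ+}
    {k : ℕ+} (hk : ∀ d ∈ (k : ℕ).properDivisors, g d.toPNat' ∈ Algebra.adjoin ℚ (ghost g '' D)) :
    g k - (k : ℚ)⁻¹ • ghost g k ∈ Algebra.adjoin ℚ (ghost g '' D) := by
  have h : g k - (k : ℚ)⁻¹ • ghost g k = -((k : ℚ)⁻¹ •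
      ∑ d ∈ (k : ℕ).properDivisors, (d : A) * g d.toPNat' ^ ((k : ℕ) / d)) := by
    rw [ghost_eq_properDivisors, natCast_mul_eq_smul, smul_add, inv_smul_smul₀ (by simp)]
    abel
  rw [h]
  exact neg_mem (Subalgebra.smul_mem _
    (sum_mem fun d hd => mul_mem (natCast_mem _ _) (pow_mem (hk d hd) _)) _)

lemma mem_adjoin_ghost (g : ℕ+ → A) {D : Set ℕ+} (hD : IsDivClosed D) (k : ℕ+) (hk : k ∈ D) :
    g k ∈ Algebra.adjoin ℚ (ghost g '' D) := by
  induction k using PNat.strongInductionOn with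
  | _ k ih =>
    have h := properDivisors_sum_mem_adjoin g (D := D) (k := k) fun d hd =>
      ih _ (toPNat'_lt_of_mem_properDivisors hd)
        (toPNat'_mem hD hk (Nat.properDivisors_subset_divisors hd))
    have h2 : (k : ℚ)⁻¹ • ghost g k ∈ Algebra.adjoin ℚ (ghost g '' D) :=
      Subalgebra.smul_mem _ (Algebra.subset_adjoin (Set.mem_image_of_mem (ghost g) hk)) _
    simpa using add_mem h h2

lemma commute_of_ghost_commute (g : ℕ+ → A)
    (hg : ∀ k l, ghost g k * ghost g l = ghost g l * ghost g k) (k l : ℕ+) :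
    Commute (g k) (g l) := by
  have hmem : ∀ k, g k ∈ Algebra.adjoin ℚ (ghost g '' Set.univ) := fun k =>
    mem_adjoin_ghost g (fun _ _ _ _ => trivial) k trivial
  have := Algebra.isMulCommutative_adjoin ℚ (s := ghost g '' Set.univ) (by
    rintro _ ⟨k, -, rfl⟩ _ ⟨l, -, rfl⟩; exact hg k l)
  exact congrArg Subtype.val (this.is_comm.comm ⟨g k, hmem k⟩ ⟨g l, hmem l⟩)

end Ghost

open scoped IsMulCommutative in
lemma exists_algHom_of_commute (R : Type*) {A ι : Type*} [CommRing R] [Ring A] [Algebra R A]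
    (g : ι → A) (hg : ∀ i j, Commute (g i) (g j)) :
    ∃ φ : MvPolynomial ι R →ₐ[R] A, ∀ i, φ (MvPolynomial.X i) = g i := by
  have := Algebra.isMulCommutative_adjoin R (s := Set.range g) (by
    rintro _ ⟨i, rfl⟩ _ ⟨j, rfl⟩; exact hg i j)
  refine ⟨(Algebra.adjoin R (Set.range g)).val.comp (MvPolynomial.aeval fun i =>
    (⟨g i, Algebra.subset_adjoin ⟨i, rfl⟩⟩ : Algebra.adjoin R (Set.range g))), fun i => ?_⟩
  simp

section CompleteSymmetric

variable {R : Type*} [CommRing R]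

/-- The power series `1 / (1 - x t ^ d)`. -/
def geomSeries (x : R) (d : ℕ) : PowerSeries R :=
  PowerSeries.mk fun n => if d ∣ n then x ^ (n / d) else 0

/-- The truncated product `∏_{d ≤ N} 1 / (1 - x_d t ^ d)`. -/
def completeSeries (x : ℕ+ → R) (N : ℕ) : PowerSeries R :=
  ∏ d ∈ Finset.range N, geomSeries (x d.succPNat) (d + 1)

/-- The logarithmic derivative `t F' / F` of `F = 1 / (1 - x t ^ d)`. -/
def geomLogDeriv (x : R) (d : ℕ) : PowerSeries R :=
  PowerSeries.mk fun n => if n ≠ 0 ∧ d ∣ n then (d : R) * x ^ (n / d) else 0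

lemma geomSeries_mul (x : R) {d : ℕ} (hd : 0 < d) :
    geomSeries x d * (1 - PowerSeries.C x * PowerSeries.X ^ d) = 1 := by
  ext n
  rw [mul_sub, mul_one, mul_left_comm, map_sub, PowerSeries.coeff_C_mul,
    PowerSeries.coeff_mul_X_pow']
  simp only [geomSeries, PowerSeries.coeff_mk, PowerSeries.coeff_one]
  rcases eq_or_ne n 0 with rfl | hn
  · simp [hd.ne']
  · rw [if_neg hn]
    by_cases h : d ∣ n
    · obtain ⟨k, rfl⟩ := h
      obtain ⟨k, rfl⟩ : ∃ j, k = j + 1 := Nat.exists_eq_succ_of_ne_zero (by rintro rfl; simp at hn)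
      have h1 : d * (k + 1) - d = d * k := by rw [mul_add, mul_one, Nat.add_sub_cancel]
      rw [if_pos (dvd_mul_right _ _), if_pos (Nat.le_mul_of_pos_right _ k.succ_pos), h1,
        if_pos (dvd_mul_right _ _), Nat.mul_div_cancel_left _ hd, Nat.mul_div_cancel_left _ hd,
        pow_succ', sub_self]
    · rw [if_neg h, zero_sub, neg_eq_zero]
      split_ifs with h1 h2
      · exact absurd ((Nat.dvd_sub_iff_left h1 dvd_rfl).1 h2) h
      · simp
      · simp

lemma geomLogDeriv_eq (x : R) (d : ℕ) :
    geomLogDeriv x d = (d : PowerSeries R) * (geomSeries x d - 1) := by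
  ext n
  rw [← map_natCast (PowerSeries.C (R := R)), PowerSeries.coeff_C_mul, map_sub]
  simp only [geomSeries, geomLogDeriv, PowerSeries.coeff_mk, PowerSeries.coeff_one]
  rcases eq_or_ne n 0 with rfl | hn
  · simp
  · by_cases h : d ∣ n <;> simp [hn, h]

lemma X_mul_derivative_geomSeries (x : R) {d : ℕ} (hd : 0 < d) :
    PowerSeries.X * PowerSeries.derivative R (geomSeries x d) =
      geomLogDeriv x d * geomSeries x d := by
  have h := geomSeries_mul x hd
  have h' := congrArg (PowerSeries.derivative R) h
  obtain ⟨e, rfl⟩ : ∃ e, d = e + 1 := Nat.exists_eq_succ_of_ne_zero hd.ne'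
  rw [geomLogDeriv_eq]
  simp only [Derivation.leibniz, map_sub, PowerSeries.derivative_pow, PowerSeries.derivative_X,
    PowerSeries.derivative_C, PowerSeries.derivative_one, smul_eq_mul, Nat.add_sub_cancel] at h'
  generalize PowerSeries.derivative R (geomSeries x (e + 1)) = F' at *
  generalize geomSeries x (e + 1) = F at *
  generalize PowerSeries.C x = c at *
  have hF : F - 1 = F * c * PowerSeries.X ^ (e + 1) := by linear_combination h
  rw [hF]
  linear_combination (PowerSeries.X * F) * h' - (PowerSeries.X * F') * h

lemma X_mul_derivative_completeSeries (x : ℕ+ → R) (N : ℕ) :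
    PowerSeries.X * PowerSeries.derivative R (completeSeries x N) =
      (∑ d ∈ Finset.range N, geomLogDeriv (x d.succPNat) (d + 1)) * completeSeries x N := by
  induction N with
  | zero => simp [completeSeries]
  | succ N ih =>
    rw [completeSeries, Finset.prod_range_succ, ← completeSeries, Finset.sum_range_succ,
      Derivation.leibniz, smul_eq_mul, smul_eq_mul]
    linear_combination geomSeries (x N.succPNat) (N + 1) * ih +
      completeSeries x N * X_mul_derivative_geomSeries (x N.succPNat) N.succ_pos

lemma coeff_completeSeries_succ_of_le (x : ℕ+ → R) {n N : ℕ} (h : n ≤ N) :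
    PowerSeries.coeff n (completeSeries x (N + 1)) = PowerSeries.coeff n (completeSeries x N) := by
  have h1 : completeSeries x (N + 1) * (1 - PowerSeries.C (x N.succPNat) * PowerSeries.X ^ (N + 1))
      = completeSeries x N := by
    rw [completeSeries, Finset.prod_range_succ, mul_assoc, geomSeries_mul _ N.succ_pos, mul_one,
      completeSeries]
  rw [← h1, mul_sub, mul_one, mul_left_comm, map_sub, PowerSeries.coeff_C_mul,
    PowerSeries.coeff_mul_X_pow', if_neg (by lia), mul_zero, sub_zero]

/-- The complete symmetric function `h_n` as a polynomial in the `x_d`. -/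
def completeSymm (x : ℕ+ → R) (n : ℕ) : R := PowerSeries.coeff n (completeSeries x n)

lemma coeff_completeSeries (x : ℕ+ → R) {n N : ℕ} (h : n ≤ N) :
    PowerSeries.coeff n (completeSeries x N) = completeSymm x n := by
  induction N, h using Nat.le_induction with
  | base => rfl
  | succ N h ih => rw [coeff_completeSeries_succ_of_le x h, ih]

lemma completeSymm_zero (x : ℕ+ → R) : completeSymm x 0 = 1 := by
  simp [completeSymm, completeSeries]

lemma coeff_sum_geomLogDeriv (x : ℕ+ → R) {n N : ℕ} (h : n < N) :
    PowerSeries.coeff (n + 1) (∑ d ∈ Finset.range N, geomLogDeriv (x d.succPNat) (d + 1)) =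
      ghost x n.succPNat := by
  rw [map_sum, ghost_eq_sum_divisors]
  simp only [geomLogDeriv, PowerSeries.coeff_mk, Nat.succPNat_coe]
  rw [← Finset.sum_filter]
  refine Finset.sum_bij' (fun d _ => d + 1) (fun d _ => d - 1) ?_ ?_ ?_ ?_ ?_
  · intro d h
    simpa using (Finset.mem_filter.1 h).2
  · intro d hd
    have h1 := Nat.pos_of_mem_divisors hd
    have h2 := Nat.divisor_le hd
    have h3 := Nat.dvd_of_mem_divisors hd
    simp only [Finset.mem_filter, Finset.mem_range, Nat.sub_add_cancel h1]
    exact ⟨by lia, by lia, h3⟩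
  · intro d _; simp
  · intro d hd
    exact Nat.sub_add_cancel (Nat.pos_of_mem_divisors hd)
  · intro d _; rfl

lemma completeSymm_newton (x : ℕ+ → R) (n : ℕ) :
    (n : R) * completeSymm x n =
      ∑ k ∈ Finset.range n, ghost x k.succPNat * completeSymm x (n - 1 - k) := by
  cases n with
  | zero => simp
  | succ n =>
    have h := congrArg (PowerSeries.coeff (n + 1)) (X_mul_derivative_completeSeries x (n + 1))
    rw [PowerSeries.coeff_succ_X_mul, PowerSeries.coeff_derivative, coeff_completeSeries x le_rfl,
      PowerSeries.coeff_mul, Finset.Nat.sum_antidiagonal_succ,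
      Finset.Nat.sum_antidiagonal_eq_sum_range_succ_mk] at h
    have h0 : PowerSeries.coeff 0 (∑ d ∈ Finset.range (n + 1),
        geomLogDeriv (x d.succPNat) (d + 1)) = 0 := by
      rw [map_sum]; simp [geomLogDeriv]
    rw [h0, zero_mul, zero_add] at h
    rw [mul_comm, Nat.cast_succ, h]
    refine Finset.sum_congr rfl fun k hk => ?_
    have hk' := Finset.mem_range.1 hk
    rw [coeff_sum_geomLogDeriv x hk', coeff_completeSeries x (by lia), Nat.add_sub_cancel]

lemma coeff_completeSeries_mem (S : Subring R) (x : ℕ+ → R) (N : ℕ)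
    (h : ∀ d < N, x d.succPNat ∈ S) (n : ℕ) : PowerSeries.coeff n (completeSeries x N) ∈ S := by
  induction N generalizing n with
  | zero =>
    simp only [completeSeries, Finset.range_zero, Finset.prod_empty, PowerSeries.coeff_one]
    split_ifs
    exacts [one_mem _, zero_mem _]
  | succ N ih =>
    rw [completeSeries, Finset.prod_range_succ, ← completeSeries, PowerSeries.coeff_mul]
    refine sum_mem fun p _ => mul_mem (ih (fun d hd => h d (by lia)) _) ?_
    simp only [geomSeries, PowerSeries.coeff_mk]
    split_ifs
    exacts [pow_mem (h N N.lt_succ_self) _, zero_mem _]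

lemma completeSymm_succ (x : ℕ+ → R) (n : ℕ) :
    completeSymm x (n + 1) =
      PowerSeries.coeff (n + 1) (completeSeries x n) + x n.succPNat := by
  have h1 : completeSeries x n = completeSeries x (n + 1) *
      (1 - PowerSeries.C (x n.succPNat) * PowerSeries.X ^ (n + 1)) := by
    rw [completeSeries, completeSeries, Finset.prod_range_succ, mul_assoc,
      geomSeries_mul _ n.succ_pos, mul_one]
  rw [h1, mul_sub, mul_one, mul_left_comm, map_sub, PowerSeries.coeff_C_mul,
    PowerSeries.coeff_mul_X_pow', if_pos le_rfl, Nat.sub_self,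
    coeff_completeSeries x (Nat.zero_le _), completeSymm_zero, ← completeSymm]
  ring

lemma mem_closure_completeSymm (x : ℕ+ → R) (n : ℕ) :
    x n.succPNat ∈ Subring.closure (Set.range (completeSymm x)) := by
  induction n using Nat.strong_induction_on with
  | _ n ih =>
    have h := completeSymm_succ x n
    rw [eq_comm, ← eq_sub_iff_add_eq'] at h
    rw [h]
    exact sub_mem (Subring.subset_closure ⟨_, rfl⟩) (coeff_completeSeries_mem _ x n ih _)

end CompleteSymmetric

section Ordering

variable {R A : Type*} [CommRing R] [Ring A] [Algebra R A]

lemma adjoin_mul_adjoin_le {S T : Set A}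
    (h : ∀ t ∈ T, ∀ s ∈ S, t * s ∈ (Algebra.adjoin R S).toSubmodule * Submodule.span R T) :
    (Algebra.adjoin R T).toSubmodule * (Algebra.adjoin R S).toSubmodule ≤
      (Algebra.adjoin R S).toSubmodule * (Algebra.adjoin R T).toSubmodule := by
  set V := Submodule.span R T
  set P := (Algebra.adjoin R S).toSubmodule
  set Q := (Algebra.adjoin R T).toSubmodule
  have hPP : P * P = P := (Algebra.adjoin R _).isIdempotentElem_toSubmodule
  have hQQ : Q * Q = Q := (Algebra.adjoin R _).isIdempotentElem_toSubmodule
  have hVQ : V ≤ Q := Submodule.span_le.2 Algebra.subset_adjoin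
  have hV : ∀ s ∈ S, ∀ v ∈ V, v * s ∈ P * V := by
    intro s hs v hv
    induction hv using Submodule.span_induction with
    | mem t ht => exact h t ht s hs
    | zero => simp
    | add a b _ _ ha hb => rw [add_mul]; exact add_mem ha hb
    | smul r a _ ha => rw [smul_mul_assoc]; exact Submodule.smul_mem _ _ ha
  have hVP : ∀ a ∈ P, ∀ v ∈ V, v * a ∈ P * V := by
    intro a ha
    induction ha using Algebra.adjoin_induction with
    | mem s hs => exact hV s hs
    | algebraMap r =>
      intro v hv
      rw [← Algebra.commutes]
      exact Submodule.mul_mem_mul (Subalgebra.algebraMap_mem _ r) hv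
    | add a b _ _ ha hb => intro v hv; rw [mul_add]; exact add_mem (ha v hv) (hb v hv)
    | mul a b _ _ ha hb =>
      intro v hv
      rw [← mul_assoc]
      have hva := ha v hv
      generalize v * a = z at hva ⊢
      induction hva using Submodule.mul_induction_on' with
      | mem_mul_mem p hp w hw =>
        rw [mul_assoc, ← hPP, mul_assoc]
        exact Submodule.mul_mem_mul hp (hb w hw)
      | add c _ d _ hc hd => rw [add_mul]; exact add_mem hc hd
  rw [Submodule.mul_le]
  intro c hc
  induction hc using Algebra.adjoin_induction with
  | mem t ht =>
    intro a ha
    exact mul_le_mul_right hVQ P (hVP a ha t (Submodule.subset_span ht))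
  | algebraMap r =>
    intro a ha
    rw [Algebra.commutes]
    exact Submodule.mul_mem_mul ha (Subalgebra.algebraMap_mem _ r)
  | add c d _ _ hc hd => intro a ha; rw [add_mul]; exact add_mem (hc a ha) (hd a ha)
  | mul c d _ _ hc hd =>
    intro a ha
    rw [mul_assoc]
    have hda := hd a ha
    generalize d * a = z at hda ⊢
    induction hda using Submodule.mul_induction_on' with
    | mem_mul_mem p hp q hq =>
      rw [← mul_assoc, ← hQQ, ← mul_assoc]
      exact Submodule.mul_mem_mul (hc p hp) hq
    | add e _ f _ he hf => rw [mul_add]; exact add_mem he hf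

lemma commutator_mem_adjoin {S : Set A} (q : A)
    (h : ∀ s ∈ S, q * s - s * q ∈ Algebra.adjoin R S) {a : A} (ha : a ∈ Algebra.adjoin R S) :
    q * a - a * q ∈ Algebra.adjoin R S := by
  induction ha using Algebra.adjoin_induction with
  | mem s hs => exact h s hs
  | algebraMap r => rw [Algebra.commutes, sub_self]; exact zero_mem _
  | add a b _ _ ha hb =>
    have e : q * (a + b) - (a + b) * q = (q * a - a * q) + (q * b - b * q) := by noncomm_ring
    rw [e]; exact add_mem ha hb
  | mul a b ha' hb' ha hb =>
    have e : q * (a * b) - (a * b) * q = (q * a - a * q) * b + a * (q * b - b * q) := by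
      noncomm_ring
    rw [e]; exact add_mem (mul_mem ha hb') (mul_mem ha' hb)

end Ordering

/-- Newton's identities, relating a sequence `h` extended by zero to the negative integers to
the power sums `p`. -/
structure IsNewton {A : Type*} [Ring A] (p : ℕ+ → A) (h : ℤ → A) : Prop where
  zero : h 0 = 1
  neg : ∀ n < 0, h n = 0
  newton : ∀ (n : ℤ) (N : ℕ), n ≤ N →
    (n : A) * h n = ∑ k ∈ Finset.range N, p k.succPNat * h (n - 1 - k)

lemma isNewton_of_nat {A : Type*} [Ring A] {p : ℕ+ → A} {h : ℕ → A} (h0 : h 0 = 1)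
    (hn : ∀ n : ℕ, (n : A) * h n = ∑ k ∈ Finset.range n, p k.succPNat * h (n - 1 - k)) :
    IsNewton p (fun n : ℤ => if 0 ≤ n then h n.toNat else 0) where
  zero := by simp [h0]
  neg n hn := if_neg (by lia)
  newton n N hN := by
    rcases lt_or_ge n 0 with hneg | hpos
    · rw [if_neg (by lia), mul_zero, Finset.sum_eq_zero]
      intro k _
      rw [if_neg (by lia), mul_zero]
    · lift n to ℕ using hpos
      rw [if_pos (by lia), Int.toNat_natCast, Int.cast_natCast, hn]
      rw [← Finset.sum_subset (Finset.range_subset_range.2 (by exact_mod_cast hN : n ≤ N))]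
      · refine Finset.sum_congr rfl fun k hk => ?_
        have := Finset.mem_range.1 hk
        rw [if_pos (by lia)]
        congr 2
        lia
      · intro k _ hk
        rw [Finset.mem_range] at hk
        rw [if_neg (by lia), mul_zero]

lemma sum_range_sum_range_shift {A : Type*} [Ring A] (F : ℕ → A) (N : ℕ)
    (hF : ∀ j, N ≤ j → F j = 0) :
    ∑ k ∈ Finset.range N, ∑ i ∈ Finset.range N, F (i + k + 1) =
      ∑ j ∈ Finset.range N, (j : A) * F j := by
  have h1 : ∀ k ∈ Finset.range N, ∑ i ∈ Finset.range N, F (i + k + 1) =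
      ∑ j ∈ Finset.range N, if k < j then F j else 0 := by
    intro k hk
    have hk := Finset.mem_range.1 hk
    rw [← Finset.sum_filter]
    symm
    refine Finset.sum_of_injOn (fun j => j - (k + 1)) ?_ ?_ ?_ ?_
    · intro a ha b hb hab
      simp only [Finset.coe_filter, Finset.mem_range, Set.mem_ofPred_eq] at ha hb
      dsimp only at hab
      lia
    · intro a ha
      simp only [Finset.coe_filter, Finset.mem_range, Set.mem_ofPred_eq, Finset.coe_range,
        Set.mem_Iio] at ha ⊢
      lia
    · intro i _ hi
      refine hF _ (not_lt.1 fun hlt => hi ⟨i + k + 1, ?_, ?_⟩)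
      · simp only [Finset.coe_filter, Finset.mem_range, Set.mem_ofPred_eq]
        lia
      · dsimp only
        lia
    · intro j hj
      simp only [Finset.mem_filter] at hj
      congr 1
      lia
  rw [Finset.sum_congr rfl h1, Finset.sum_comm]
  refine Finset.sum_congr rfl fun j hj => ?_
  have hj := Finset.mem_range.1 hj
  rw [← Finset.sum_filter, Finset.sum_const, nsmul_eq_mul]
  congr 2
  have : Finset.filter (fun k => k < j) (Finset.range N) = Finset.range j := by
    ext k
    simp only [Finset.mem_filter, Finset.mem_range]
    lia
  rw [this, Finset.card_range]

section Heisenberg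

variable {A : Type*} [Ring A] [Algebra ℚ A] {p q : ℕ+ → A} {h g : ℤ → A}

lemma mul_complete_eq (hpq : ∀ k l, q l * p k = p k * q l + if k = l then ((k : ℕ) : A) else 0)
    (hh : IsNewton p h) (l : ℕ+) (m : ℤ) : q l * h m = h m * q l + h (m - l) := by
  rcases lt_or_ge m 0 with hneg | hpos
  · rw [hh.neg m hneg, hh.neg _ (by have := l.pos; lia)]
    simp
  lift m to ℕ using hpos
  induction m using Nat.strong_induction_on with
  | _ m ih =>
    rcases eq_or_ne m 0 with rfl | hm
    · have := l.pos
      rw [Nat.cast_zero, hh.zero, hh.neg _ (by lia)]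
      simp
    refine natCast_mul_injective hm ?_
    have hN := hh.newton m (m + l) (by lia)
    have hN' := hh.newton (m - l) (m + l) (by lia)
    rw [Int.cast_natCast] at hN
    have key : ∀ k ∈ Finset.range (m + l), q l * (p k.succPNat * h (m - 1 - k)) =
        p k.succPNat * h (m - 1 - k) * q l + p k.succPNat * h (m - l - 1 - k) +
          if k = l - 1 then (l : ℕ) * h (m - l) else 0 := by
      intro k _
      have ih' : q l * h (m - 1 - k) = h (m - 1 - k) * q l + h (m - l - 1 - k) := by
        rcases lt_or_ge (m - 1 - k : ℤ) 0 with hneg | hpos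
        · rw [hh.neg _ hneg, hh.neg _ (by have := l.pos; lia)]
          simp
        · have := ih (m - 1 - k) (by lia)
          rw [show ((m - 1 - k : ℕ) : ℤ) = m - 1 - k by lia] at this
          rw [this]
          congr 2
          lia
      rw [← mul_assoc, hpq, add_mul, mul_assoc, ih', mul_add, ← mul_assoc]
      congr 1
      have hl := l.pos
      by_cases hk : k = l - 1
      · have e : k.succPNat = l := PNat.eq (by rw [Nat.succPNat_coe]; lia)
        rw [if_pos e, if_pos hk, e]
        congr 2
        lia
      · have e : k.succPNat ≠ l := fun e => hk (by rw [← e, Nat.succPNat_coe]; lia)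
        rw [if_neg e, if_neg hk, zero_mul]
    calc (m : A) * (q l * h m) = q l * ((m : A) * h m) := by
          rw [← mul_assoc, (Nat.cast_commute m (q l)).eq, mul_assoc]
      _ = (m : A) * h m * q l + ((m - l : ℤ) : A) * h (m - l) + (l : ℕ) * h (m - l) := by
          rw [hN, hN', Finset.mul_sum, Finset.sum_congr rfl key, Finset.sum_add_distrib,
            Finset.sum_add_distrib, Finset.sum_mul, Finset.sum_ite_eq',
            if_pos (Finset.mem_range.2 (by have := l.pos; lia))]
      _ = _ := by push_cast; noncomm_ring

lemma complete_mul_complete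
    (hpq : ∀ k l, q l * p k = p k * q l + if k = l then ((k : ℕ) : A) else 0)
    (hh : IsNewton p h) (hg : IsNewton q g) (m : ℤ) (n N : ℕ) (hN : n < N) :
    g n * h m = ∑ i ∈ Finset.range N, h (m - i) * g (n - i) := by
  induction n using Nat.strong_induction_on with
  | _ n ih =>
    rcases eq_or_ne n 0 with rfl | hn
    · rw [Finset.sum_eq_single_of_mem 0 (Finset.mem_range.2 hN)]
      · simp [hg.zero]
      · intro i _ hi
        rw [hg.neg _ (by lia), mul_zero]
    refine natCast_mul_injective hn ?_
    have ih' : ∀ k : ℕ, g (n - 1 - k) * h m =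
        ∑ i ∈ Finset.range N, h (m - i) * g (n - 1 - k - i) := by
      intro k
      rcases lt_or_ge (n - 1 - k : ℤ) 0 with hneg | hpos
      · rw [hg.neg _ hneg, zero_mul, Finset.sum_eq_zero]
        intro i _
        rw [hg.neg _ (by lia), mul_zero]
      · have := ih (n - 1 - k) (by lia) (by lia)
        rwa [show ((n - 1 - k : ℕ) : ℤ) = n - 1 - k by lia] at this
    have hsum := sum_range_sum_range_shift (fun j : ℕ => h (m - j) * g (n - j)) N
      (fun j hj => by rw [hg.neg _ (by lia), mul_zero])
    have hNn := hg.newton n N (by lia)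
    rw [Int.cast_natCast] at hNn
    calc (n : A) * (g n * h m)
        = ∑ k ∈ Finset.range N, ∑ i ∈ Finset.range N,
            (h (m - i) * (q k.succPNat * g (n - i - 1 - k)) +
              h (m - (i + k + 1 : ℕ)) * g (n - (i + k + 1 : ℕ))) := by
          rw [← mul_assoc, hNn, Finset.sum_mul]
          refine Finset.sum_congr rfl fun k _ => ?_
          rw [mul_assoc, ih', Finset.mul_sum]
          refine Finset.sum_congr rfl fun i _ => ?_
          rw [← mul_assoc, mul_complete_eq hpq hh, add_mul, mul_assoc]
          congr 1
          · congr 3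
            lia
          · rw [Nat.succPNat_coe]
            congr 2 <;> push_cast <;> ring
      _ = ∑ i ∈ Finset.range N, h (m - i) * (((n - i : ℤ) : A) * g (n - i)) +
            ∑ j ∈ Finset.range N, (j : A) * (h (m - j) * g (n - j)) := by
          simp only [Finset.sum_add_distrib]
          rw [hsum, Finset.sum_comm]
          congr 1
          refine Finset.sum_congr rfl fun i _ => ?_
          rw [hg.newton (n - i) N (by lia), Finset.mul_sum]
      _ = _ := by
          rw [← Finset.sum_add_distrib, Finset.mul_sum]
          refine Finset.sum_congr rfl fun i _ => ?_
          rw [← mul_assoc, ← (Int.cast_commute (n - i : ℤ) (h (m - i))).eq]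
          push_cast
          noncomm_ring

end Heisenberg

section Evaluation

open MvPolynomial

variable {R A : Type*} [CommRing R] [Ring A] [Algebra R A]

/-- `pEval` as a linear map. -/
def pEvalLin {σ : Type*} [LinearOrder σ] (R : Type*) [CommRing R] [Algebra R A] (x : σ → A) :
    MvPolynomial σ R →ₗ[R] A :=
  (basisMonomials σ R).constr R (ordProd x)

lemma pEvalLin_monomial {σ : Type*} [LinearOrder σ] (x : σ → A) (e : σ →₀ ℕ) (c : R) :
    pEvalLin R x (monomial e c) = c • ordProd x e := by
  have h : monomial e c = c • basisMonomials σ R e := by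
    rw [coe_basisMonomials, smul_monomial, smul_eq_mul, mul_one]
  rw [h, map_smul, pEvalLin, Module.Basis.constr_basis]

lemma pEvalLin_apply {σ : Type*} [LinearOrder σ] (x : σ → A) (q : MvPolynomial σ R) :
    pEvalLin R x q = pEval x q := by
  conv_lhs => rw [q.as_sum]
  rw [map_sum, pEval]
  exact Finset.sum_congr rfl fun e _ => pEvalLin_monomial x e _

lemma pEvalLin_map {σ : Type*} [LinearOrder σ] {S : Type*} [CommRing S] [Algebra R S]
    [Algebra S A] [IsScalarTower R S A] (x : σ → A) (q : MvPolynomial σ R) :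
    pEvalLin S x (map (algebraMap R S) q) = pEvalLin R x q := by
  induction q using MvPolynomial.induction_on' with
  | monomial e c => rw [map_monomial, pEvalLin_monomial, pEvalLin_monomial, algebraMap_smul]
  | add p q hp hq => rw [map_add, map_add, map_add, hp, hq]

variable {x y : ℕ+ → A} {φ ψ : MvPolynomial ℕ+ R →ₐ[R] A}

/-- The family `X_d ↦ x_d`, `Y_e ↦ y_e`. -/
def sumFamily {A : Type*} (x y : ℕ+ → A) (v : ℕ+ ⊕ₗ ℕ+) : A := Sum.elim x y (ofLex v)

@[simp] lemma sumFamily_inl {A : Type*} (x y : ℕ+ → A) (d : ℕ+) :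
    sumFamily x y (toLex (Sum.inl d)) = x d := rfl

@[simp] lemma sumFamily_inr {A : Type*} (x y : ℕ+ → A) (d : ℕ+) :
    sumFamily x y (toLex (Sum.inr d)) = y d := rfl

lemma ordProd_sumFamily (hφ : ∀ d, φ (X d) = x d) (hψ : ∀ d, ψ (X d) = y d)
    (e : (ℕ+ ⊕ₗ ℕ+) →₀ ℕ) : ordProd (sumFamily x y) e =
      φ (e.prod fun v n => sumFamily X 1 v ^ n) * ψ (e.prod fun v n => sumFamily 1 X v ^ n) := by
  have key : ∀ l : List (ℕ+ ⊕ₗ ℕ+), l.Pairwise (· ≤ ·) →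
      (l.map fun v => sumFamily x y v ^ e v).prod =
        φ (l.map fun v => sumFamily X 1 v ^ e v).prod *
          ψ (l.map fun v => sumFamily 1 X v ^ e v).prod := by
    intro l hl
    induction l with
    | nil => simp
    | cons a l ih =>
      rw [List.pairwise_cons] at hl
      rw [List.map_cons, List.map_cons, List.map_cons, List.prod_cons, List.prod_cons,
        List.prod_cons, ih hl.2]
      induction a using Lex.rec with
      | _ a =>
        cases a with
        | inl d => simp [hφ, mul_assoc]
        | inr d =>
          have h1 : (l.map fun v => sumFamily (X : ℕ+ → MvPolynomial ℕ+ R) 1 v ^ e v).prod = 1 := by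
            refine List.prod_eq_one fun z hz => ?_
            obtain ⟨v, hv, rfl⟩ := List.mem_map.1 hz
            have hle := hl.1 v hv
            induction v using Lex.rec with
            | _ v =>
              cases v with
              | inl d' => exact absurd hle Sum.Lex.not_inr_le_inl
              | inr d' => simp
          rw [h1]
          simp [hψ]
  have hprod : ∀ f : (ℕ+ ⊕ₗ ℕ+) → MvPolynomial ℕ+ R,
      ((e.support.sort (· ≤ ·)).map fun v => f v ^ e v).prod = e.prod fun v n => f v ^ n := by
    intro f
    rw [← List.prod_toFinset _ (Finset.sort_nodup _ _), Finset.sort_toFinset, Finsupp.prod]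
  rw [ordProd, key _ (Finset.pairwise_sort _ _), hprod, hprod]

lemma pEvalLin_rename_mul_rename (hφ : ∀ d, φ (X d) = x d) (hψ : ∀ d, ψ (X d) = y d)
    (a b : MvPolynomial ℕ+ R) :
    pEvalLin R (sumFamily x y)
      (rename (fun d => toLex (Sum.inl d)) a * rename (fun d => toLex (Sum.inr d)) b) =
        φ a * ψ b := by
  induction a using MvPolynomial.induction_on' with
  | add p q hp hq => rw [map_add, add_mul, map_add, hp, hq, map_add, add_mul]
  | monomial α c =>
    induction b using MvPolynomial.induction_on' with
    | add p q hp hq => rw [map_add, mul_add, map_add, hp, hq, map_add, mul_add]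
    | monomial β c' =>
      rw [rename_monomial, rename_monomial, monomial_mul, pEvalLin_monomial,
        ordProd_sumFamily hφ hψ, Finsupp.prod_add_index' (by simp) (by intros; rw [pow_add]),
        Finsupp.prod_add_index' (by simp) (by intros; rw [pow_add]),
        Finsupp.prod_mapDomain_index (by simp) (by intros; rw [pow_add]),
        Finsupp.prod_mapDomain_index (by simp) (by intros; rw [pow_add]),
        Finsupp.prod_mapDomain_index (by simp) (by intros; rw [pow_add]),
        Finsupp.prod_mapDomain_index (by simp) (by intros; rw [pow_add])]
      rw [monomial_eq (s := α), monomial_eq (s := β), ← smul_eq_C_mul, ← smul_eq_C_mul, map_smul,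
        map_smul, smul_mul_smul_comm]
      simp

lemma adjoin_mul_adjoin_le_map_supported (hφ : ∀ d, φ (X d) = x d) (hψ : ∀ d, ψ (X d) = y d)
    {D E : Set ℕ+} {S : Set (ℕ+ ⊕ₗ ℕ+)} (hD : ∀ d ∈ D, toLex (Sum.inl d) ∈ S)
    (hE : ∀ d ∈ E, toLex (Sum.inr d) ∈ S) :
    (Algebra.adjoin R (x '' D)).toSubmodule * (Algebra.adjoin R (y '' E)).toSubmodule ≤
      (supported R S).toSubmodule.map (pEvalLin R (sumFamily x y)) := by
  have himage : ∀ (θ : MvPolynomial ℕ+ R →ₐ[R] A) (z : ℕ+ → A) (hθ : ∀ d, θ (X d) = z d)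
      (F : Set ℕ+), Algebra.adjoin R (z '' F) = (supported R F).map θ := by
    intro θ z hθ F
    rw [supported, AlgHom.map_adjoin, Set.image_image]
    simp only [hθ]
  have hrename : ∀ (f : ℕ+ → ℕ+ ⊕ₗ ℕ+) (F : Set ℕ+), (∀ d ∈ F, f d ∈ S) →
      ∀ a ∈ supported R F, rename f a ∈ supported R S := by
    intro f F hf a ha
    have h : (supported R F).map (rename f) ≤ supported R S := by
      rw [supported, AlgHom.map_adjoin, Algebra.adjoin_le_iff]
      rintro _ ⟨_, ⟨d, hd, rfl⟩, rfl⟩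
      simpa [supported] using Algebra.subset_adjoin (Set.mem_image_of_mem X (hf d hd))
    exact h ⟨a, ha, rfl⟩
  rw [himage φ x hφ, himage ψ y hψ, Submodule.mul_le]
  rintro _ ⟨a, ha, rfl⟩ _ ⟨b, hb, rfl⟩
  exact ⟨_, Subalgebra.mul_mem _ (hrename _ D hD a ha) (hrename _ E hE b hb),
    pEvalLin_rename_mul_rename hφ hψ a b⟩

end Evaluation

section Commutator

variable {A : Type*} [Ring A] {x y : ℕ+ → A}

lemma exists_isNewton (hx : ∀ k l, Commute (x k) (x l)) :
    ∃ h : ℤ → A, IsNewton (ghost x) h ∧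
      Algebra.adjoin ℤ (Set.range x) = Algebra.adjoin ℤ (Set.range h) := by
  obtain ⟨φ, hφ⟩ := exists_algHom_of_commute ℤ x hx
  have hghost : ∀ k, φ (ghost MvPolynomial.X k) = ghost x k := fun k => by
    rw [map_ghost]; simp only [hφ]
  refine ⟨_, isNewton_of_nat (h := fun n => φ (completeSymm MvPolynomial.X n))
    (by rw [completeSymm_zero, map_one]) fun n => ?_, le_antisymm ?_ ?_⟩
  · have h := congrArg φ (completeSymm_newton MvPolynomial.X n)
    simpa only [map_mul, map_natCast, map_sum, hghost] using h
  · rw [Algebra.adjoin_le_iff]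
    rintro _ ⟨d, rfl⟩
    have hd := mem_closure_completeSymm (R := MvPolynomial ℕ+ ℤ) MvPolynomial.X d.natPred
    rw [PNat.succPNat_natPred] at hd
    rw [← hφ]
    refine (Subring.closure_le (t := (Algebra.adjoin ℤ _).toSubring.comap φ.toRingHom)).2 ?_ hd
    rintro _ ⟨n, rfl⟩
    exact Algebra.subset_adjoin ⟨n, by simp⟩
  · have hrange : ∀ p, φ p ∈ Algebra.adjoin ℤ (Set.range x) := fun p => by
      have hp : p ∈ Algebra.adjoin ℤ (Set.range (MvPolynomial.X : ℕ+ → MvPolynomial ℕ+ ℤ)) := by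
        rw [MvPolynomial.adjoin_range_X]; trivial
      have hp' : φ p ∈ (Algebra.adjoin ℤ (Set.range MvPolynomial.X)).map φ := ⟨p, hp, rfl⟩
      rw [AlgHom.map_adjoin, ← Set.range_comp] at hp'
      exact (funext hφ : φ ∘ MvPolynomial.X = x) ▸ hp'
    rw [Algebra.adjoin_le_iff]
    rintro _ ⟨n, rfl⟩
    dsimp only
    split_ifs
    exacts [hrange _, zero_mem _]

variable [Algebra ℚ A]

lemma commutator_mem_integral
    (hx : ∀ k l, ghost x k * ghost x l = ghost x l * ghost x k)
    (hy : ∀ k l, ghost y k * ghost y l = ghost y l * ghost y k)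
    (hyx : ∀ k l, ghost y l * ghost x k =
      ghost x k * ghost y l + if k = l then ((k : ℕ) : A) else 0) (m n : ℕ+) :
    y n * x m - x m * y n ∈ (Algebra.adjoin ℤ (Set.range x)).toSubmodule *
      (Algebra.adjoin ℤ (Set.range y)).toSubmodule := by
  have hxm : x m ∈ Algebra.adjoin ℤ (Set.range x) := Algebra.subset_adjoin ⟨m, rfl⟩
  have hyn : y n ∈ Algebra.adjoin ℤ (Set.range y) := Algebra.subset_adjoin ⟨n, rfl⟩
  refine sub_mem ?_ (Submodule.mul_mem_mul hxm hyn)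
  obtain ⟨h, hh, hxh⟩ := exists_isNewton (commute_of_ghost_commute x hx)
  obtain ⟨g, hg, hyg⟩ := exists_isNewton (commute_of_ghost_commute y hy)
  rw [hxh] at hxm ⊢
  rw [hyg] at hyn ⊢
  refine adjoin_mul_adjoin_le ?_ (Submodule.mul_mem_mul hyn hxm)
  rintro _ ⟨j, rfl⟩ _ ⟨i, rfl⟩
  rcases lt_or_ge j 0 with hneg | hpos
  · rw [hg.neg j hneg, zero_mul]
    exact zero_mem _
  · lift j to ℕ using hpos
    rw [complete_mul_complete hyx hh hg i j (j + 1) j.lt_succ_self]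
    exact sum_mem fun k _ => Submodule.mul_mem_mul (Algebra.subset_adjoin ⟨_, rfl⟩)
      (Submodule.subset_span ⟨_, rfl⟩)

/-- The proper divisors of a positive integer. -/
def properDivs (m : ℕ+) : Set ℕ+ := {d | (d : ℕ) ∣ (m : ℕ) ∧ d ≠ m}

lemma isDivClosed_properDivs (m : ℕ+) : IsDivClosed (properDivs m) := by
  rintro k ⟨hk, hkm⟩ d hd
  refine ⟨hd.trans hk, ?_⟩
  rintro rfl
  exact hkm (PNat.eq (Nat.dvd_antisymm hk hd))

lemma toPNat'_mem_properDivs {m : ℕ+} {d : ℕ} (h : d ∈ (m : ℕ).properDivisors) :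
    d.toPNat' ∈ properDivs m := by
  refine ⟨?_, (toPNat'_lt_of_mem_properDivisors h).ne⟩
  rw [Nat.toPNat'_coe, if_pos (Nat.pos_of_mem_properDivisors h)]
  exact (Nat.mem_properDivisors.1 h).1

lemma sub_ghost_mem_adjoin (m : ℕ+) :
    x m - (m : ℚ)⁻¹ • ghost x m ∈ Algebra.adjoin ℚ (ghost x '' properDivs m) :=
  properDivisors_sum_mem_adjoin x fun _ hd =>
    mem_adjoin_ghost x (isDivClosed_properDivs m) _ (toPNat'_mem_properDivs hd)

lemma adjoin_ghost_le {D : Set ℕ+} (hD : IsDivClosed D) :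
    Algebra.adjoin ℚ (ghost x '' D) ≤ Algebra.adjoin ℚ (x '' D) := by
  rw [Algebra.adjoin_le_iff]
  rintro _ ⟨k, hk, rfl⟩
  exact ghost_mem_adjoin x hD hk

lemma commutator_mem_rational
    (hyx : ∀ k l, ghost y l * ghost x k =
      ghost x k * ghost y l + if k = l then ((k : ℕ) : A) else 0) (m n : ℕ+) :
    y n * x m - x m * y n ∈ (Algebra.adjoin ℚ (x '' properDivs m)).toSubmodule *
      (Algebra.adjoin ℚ (y '' properDivs n)).toSubmodule := by
  have hx := Subalgebra.toSubmodule.monotone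
    (adjoin_ghost_le (x := x) (isDivClosed_properDivs m))
  have hy := Subalgebra.toSubmodule.monotone
    (adjoin_ghost_le (x := y) (isDivClosed_properDivs n))
  refine mul_le_mul' hx hy ?_
  have hQP := adjoin_mul_adjoin_le (R := ℚ) (S := ghost x '' properDivs m)
    (T := insert 1 (ghost y '' properDivs n)) (by
      intro t ht s hs
      obtain ⟨k, hk, rfl⟩ := hs
      have hxk : ghost x k ∈ Algebra.adjoin ℚ (ghost x '' properDivs m) :=
        Algebra.subset_adjoin ⟨k, hk, rfl⟩
      rcases ht with rfl | ⟨l, hl, rfl⟩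
      · rw [one_mul, ← mul_one (ghost x k)]
        exact Submodule.mul_mem_mul hxk (Submodule.subset_span (Set.mem_insert _ _))
      · rw [hyx]
        refine add_mem (Submodule.mul_mem_mul hxk
          (Submodule.subset_span (Set.mem_insert_of_mem _ ⟨l, hl, rfl⟩))) ?_
        split_ifs
        · rw [← mul_one ((k : ℕ) : A)]
          exact Submodule.mul_mem_mul (natCast_mem (Algebra.adjoin ℚ _) _)
            (Submodule.subset_span (Set.mem_insert _ _))
        · exact zero_mem _)
  rw [Algebra.adjoin_insert_one] at hQP
  have ha := sub_ghost_mem_adjoin (x := x) m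
  have hb := sub_ghost_mem_adjoin (x := y) n
  set P := Algebra.adjoin ℚ (ghost x '' properDivs m)
  set Q := Algebra.adjoin ℚ (ghost y '' properDivs n)
  have hP : ∀ a ∈ P, a ∈ P.toSubmodule * Q.toSubmodule := fun a h => by
    simpa using Submodule.mul_mem_mul (M := P.toSubmodule) (N := Q.toSubmodule) h (one_mem Q)
  have hQ : ∀ a ∈ Q, a ∈ P.toSubmodule * Q.toSubmodule := fun a h => by
    simpa using Submodule.mul_mem_mul (M := P.toSubmodule) (N := Q.toSubmodule) (one_mem P) h
  have hscalar : ∀ k l, ghost y l * ghost x k - ghost x k * ghost y l ∈ P ∧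
      ghost x k * ghost y l - ghost y l * ghost x k ∈ Q := by
    intro k l
    rw [hyx, add_sub_cancel_left, sub_add_cancel_left]
    split_ifs
    · exact ⟨natCast_mem _ _, neg_mem (natCast_mem _ _)⟩
    · exact ⟨zero_mem _, neg_mem (zero_mem _)⟩
  have hqa := commutator_mem_adjoin (ghost y n) (by
    rintro _ ⟨k, -, rfl⟩; exact (hscalar k n).1) ha
  have hpb := commutator_mem_adjoin (ghost x m) (by
    rintro _ ⟨l, -, rfl⟩; exact (hscalar m l).2) hb
  have hba := sub_mem (hQP (Submodule.mul_mem_mul hb ha)) (Submodule.mul_mem_mul ha hb)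
  have e : y n * x m - x m * y n =
      ((y n - (n : ℚ)⁻¹ • ghost y n) * (x m - (m : ℚ)⁻¹ • ghost x m) -
        (x m - (m : ℚ)⁻¹ • ghost x m) * (y n - (n : ℚ)⁻¹ • ghost y n)) +
      (n : ℚ)⁻¹ • (ghost y n * (x m - (m : ℚ)⁻¹ • ghost x m) -
        (x m - (m : ℚ)⁻¹ • ghost x m) * ghost y n) -
      (m : ℚ)⁻¹ • (ghost x m * (y n - (n : ℚ)⁻¹ • ghost y n) -
        (y n - (n : ℚ)⁻¹ • ghost y n) * ghost x m) +
      ((m : ℚ)⁻¹ * (n : ℚ)⁻¹) • (ghost y n * ghost x m - ghost x m * ghost y n) := by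
    simp only [mul_sub, sub_mul, smul_sub, mul_smul_comm, smul_mul_assoc, mul_smul,
      smul_comm (m : ℚ)⁻¹ (n : ℚ)⁻¹]
    abel
  rw [e]
  exact add_mem (sub_mem (add_mem hba (Submodule.smul_mem _ _ (hP _ hqa)))
    (Submodule.smul_mem _ _ (hQ _ hpb))) (Submodule.smul_mem _ _ (hP _ (hscalar m n).1))

end Commutator

section Representation

open MvPolynomial

/-- The polynomial algebra on which `B(ℚ)` acts. -/
abbrev PolyXY : Type := MvPolynomial (ℕ+ ⊕ ℕ+) ℚ

/-- The endomorphism `l · ∂/∂X_l + Y_l`. -/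
def raising (l : ℕ+) : Module.End ℚ PolyXY :=
  (l : ℚ) • (pderiv (Sum.inl l)).toLinearMap + Algebra.lmul ℚ PolyXY (X (Sum.inr l))

lemma raising_apply (l : ℕ+) (f : PolyXY) :
    raising l f = (l : ℚ) • pderiv (Sum.inl l) f + X (Sum.inr l) * f := rfl

lemma pderiv_comm {σ R : Type*} [CommRing R] (i j : σ) (f : MvPolynomial σ R) :
    pderiv i (pderiv j f) = pderiv j (pderiv i f) := by
  classical
  have h : ⁅(pderiv i : Derivation R (MvPolynomial σ R) (MvPolynomial σ R)),
      (pderiv j : Derivation R (MvPolynomial σ R) (MvPolynomial σ R))⁆ = 0 := by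
    refine derivation_ext fun k => ?_
    rw [Derivation.commutator_apply, pderiv_X, pderiv_X]
    simp [Pi.single_apply, apply_ite]
  have h' := congrArg (fun D : Derivation R (MvPolynomial σ R) (MvPolynomial σ R) => D f) h
  simpa [Derivation.commutator_apply, sub_eq_zero] using h'

lemma raising_comm (k l : ℕ+) : raising k * raising l = raising l * raising k := by
  refine LinearMap.ext fun f => ?_
  simp only [Module.End.mul_apply, raising_apply, map_add, map_smul, Derivation.leibniz,
    pderiv_X_of_ne (Sum.inr_ne_inl), smul_eq_mul, mul_zero, add_zero, smul_add]
  rw [pderiv_comm (Sum.inl k), smul_comm (k : ℚ), mul_left_comm]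
  abel

lemma raising_lmul (k l : ℕ+) : raising l * Algebra.lmul ℚ PolyXY (X (Sum.inl k)) =
    Algebra.lmul ℚ PolyXY (X (Sum.inl k)) * raising l +
      if k = l then ((k : ℕ) : Module.End ℚ PolyXY) else 0 := by
  refine LinearMap.ext fun f => ?_
  simp only [Module.End.mul_apply, raising_apply, LinearMap.add_apply, Algebra.coe_lmul_eq_mul,
    LinearMap.mul_apply', Derivation.leibniz, smul_eq_mul, mul_add, smul_add, mul_smul_comm]
  rw [mul_left_comm (X (Sum.inr l))]
  split_ifs with h
  · subst h
    rw [pderiv_X_self, mul_one, Module.End.natCast_apply, ← Nat.cast_smul_eq_nsmul ℚ]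
    abel
  · rw [pderiv_X_of_ne (by simpa using h), mul_zero, smul_zero, LinearMap.zero_apply]
    abel

/-- Pairs `(T, t)` such that `T` acts as multiplication by `t` on the polynomials in the `Y_l`,
where `t` is such a polynomial itself. -/
def actsByMul : Subalgebra ℚ (Module.End ℚ PolyXY × PolyXY) where
  carrier := {p | (∀ l, pderiv (Sum.inl l) p.2 = 0) ∧
    ∀ f : PolyXY, (∀ l, pderiv (Sum.inl l) f = 0) → p.1 f = p.2 * f}
  mul_mem' := by
    rintro p q ⟨hp, hp'⟩ ⟨hq, hq'⟩
    refine ⟨fun l => by simp [Derivation.leibniz, hp, hq], fun f hf => ?_⟩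
    rw [Prod.fst_mul, Module.End.mul_apply, hq' f hf,
      hp' _ fun l => by simp [Derivation.leibniz, hq, hf], Prod.snd_mul, mul_assoc]
  add_mem' := by
    rintro p q ⟨hp, hp'⟩ ⟨hq, hq'⟩
    refine ⟨fun l => by simp [hp, hq], fun f hf => ?_⟩
    rw [Prod.fst_add, LinearMap.add_apply, hp' f hf, hq' f hf, Prod.snd_add, add_mul]
  algebraMap_mem' := fun r => by
    refine ⟨fun l => ?_, fun f _ => ?_⟩
    · rw [Prod.algebraMap_apply, Derivation.map_algebraMap]
    · rw [Prod.algebraMap_apply, Module.algebraMap_end_apply, Algebra.smul_def]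

/-- The elements of `actsByMul` whose ghost values are the pairs `(l · ∂/∂X_l + Y_l, Y_l)`. -/
def yPair : ℕ+ → actsByMul := ghostInv fun l => ⟨(raising l, X (Sum.inr l)),
  fun _ => pderiv_X_of_ne Sum.inr_ne_inl, fun f hf => by
    rw [raising_apply, hf, smul_zero, zero_add]⟩

/-- The polynomials with ghost values `X_l`. -/
def xPoly : ℕ+ → PolyXY := ghostInv fun l => X (Sum.inl l)

/-- The polynomials with ghost values `Y_l`. -/
def yPoly (l : ℕ+) : PolyXY := (yPair l : Module.End ℚ PolyXY × PolyXY).2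

lemma ghost_yPoly (k : ℕ+) : ghost yPoly k = X (Sum.inr k) := by
  have h := map_ghost ((AlgHom.snd ℚ (Module.End ℚ PolyXY) PolyXY).comp actsByMul.val) yPair k
  exact h.symm.trans (by rw [yPair, ghost_ghostInv]; rfl)

lemma ghost_fst_yPair (k : ℕ+) :
    ghost (fun l => (yPair l : Module.End ℚ PolyXY × PolyXY).1) k = raising k := by
  have h := map_ghost ((AlgHom.fst ℚ (Module.End ℚ PolyXY) PolyXY).comp actsByMul.val) yPair k
  exact h.symm.trans (by rw [yPair, ghost_ghostInv]; rfl)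

lemma ghost_lmul_xPoly (k : ℕ+) :
    ghost (fun l => Algebra.lmul ℚ PolyXY (xPoly l)) k = Algebra.lmul ℚ PolyXY (X (Sum.inl k)) := by
  rw [← map_ghost, xPoly, ghost_ghostInv]

lemma exists_representation : ∃ ρ : BQ →ₐ[ℚ] Module.End ℚ PolyXY,
    (∀ d, ρ (bx d) = Algebra.lmul ℚ PolyXY (xPoly d)) ∧
      ∀ d, ρ (by' d) = (yPair d : Module.End ℚ PolyXY × PolyXY).1 := by
  let g := FreeAlgebra.lift ℚ (Sum.elim (fun l => Algebra.lmul ℚ PolyXY (xPoly l))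
    fun l => (yPair l : Module.End ℚ PolyXY × PolyXY).1)
  have hx : ∀ d, g (bXf d) = Algebra.lmul ℚ PolyXY (xPoly d) := fun d =>
    FreeAlgebra.lift_ι_apply _ _
  have hy : ∀ d, g (bYf d) = (yPair d : Module.End ℚ PolyXY × PolyXY).1 := fun d =>
    FreeAlgebra.lift_ι_apply _ _
  have hgx : ∀ k, g (ghost bXf k) = Algebra.lmul ℚ PolyXY (X (Sum.inl k)) := fun k => by
    rw [map_ghost, ← ghost_lmul_xPoly]; simp only [hx]
  have hgy : ∀ k, g (ghost bYf k) = raising k := fun k => by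
    rw [map_ghost, ← ghost_fst_yPair]; simp only [hy]
  have hg : ∀ ⦃a b⦄, BRel a b → g a = g b := by
    rintro _ _ (⟨k, l⟩ | ⟨k, l⟩ | ⟨k, l⟩)
    · rw [map_mul, map_mul, hgx, hgx, ← map_mul, ← map_mul, mul_comm]
    · rw [map_mul, map_mul, hgy, hgy, raising_comm]
    · rw [map_add, map_mul, map_mul, hgx, hgy, raising_lmul, apply_ite g, map_natCast, map_zero]
  refine ⟨RingQuot.liftAlgHom ℚ ⟨g, hg⟩, fun d => ?_, fun d => ?_⟩
  · rw [bx, RingQuot.liftAlgHom_mkAlgHom_apply, hx]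
  · rw [by', RingQuot.liftAlgHom_mkAlgHom_apply, hy]

lemma ghost_bx_mul (k l : ℕ+) : ghost bx k * ghost bx l = ghost bx l * ghost bx k := by
  have h := RingQuot.mkAlgHom_rel ℚ (BRel.xx k l)
  rwa [map_mul, map_mul, map_ghost, map_ghost] at h

lemma ghost_by'_mul (k l : ℕ+) : ghost by' k * ghost by' l = ghost by' l * ghost by' k := by
  have h := RingQuot.mkAlgHom_rel ℚ (BRel.yy k l)
  rwa [map_mul, map_mul, map_ghost, map_ghost] at h

lemma ghost_by'_mul_ghost_bx (k l : ℕ+) : ghost by' l * ghost bx k =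
    ghost bx k * ghost by' l + if k = l then ((k : ℕ) : BQ) else 0 := by
  have h := RingQuot.mkAlgHom_rel ℚ (BRel.yx k l)
  rwa [map_add, map_mul, map_mul, map_ghost, map_ghost,
    apply_ite (RingQuot.mkAlgHom ℚ BRel), map_natCast, map_zero] at h

lemma aeval_sumFamily_injective :
    Function.Injective (aeval (R := ℚ) (sumFamily xPoly yPoly)) := by
  let θ : PolyXY →ₐ[ℚ] MvPolynomial (ℕ+ ⊕ₗ ℕ+) ℚ :=
    aeval (Sum.elim (ghost fun d => X (toLex (Sum.inl d))) (ghost fun d => X (toLex (Sum.inr d))))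
  have hx : ∀ d, θ (xPoly d) = X (toLex (Sum.inl d)) := ghost_injective fun k => by
    rw [← map_ghost, xPoly, ghost_ghostInv, aeval_X, Sum.elim_inl]
  have hy : ∀ d, θ (yPoly d) = X (toLex (Sum.inr d)) := ghost_injective fun k => by
    rw [← map_ghost, ghost_yPoly, aeval_X, Sum.elim_inr]
  have h : θ.comp (aeval (sumFamily xPoly yPoly)) = AlgHom.id ℚ _ := by
    refine algHom_ext fun v => ?_
    rw [AlgHom.comp_apply, aeval_X]
    rcases v with d | d
    exacts [hx d, hy d]
  exact Function.LeftInverse.injective (g := θ) fun p => congrArg (fun F => F p) h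

lemma pEvalLin_injective : Function.Injective (pEvalLin ℚ (sumFamily bx by')) := by
  obtain ⟨ρ, hρx, hρy⟩ := exists_representation
  obtain ⟨φ, hφ⟩ := exists_algHom_of_commute ℚ bx (commute_of_ghost_commute bx ghost_bx_mul)
  obtain ⟨ψ, hψ⟩ := exists_algHom_of_commute ℚ by' (commute_of_ghost_commute by' ghost_by'_mul)
  have hρφ : ∀ a, ρ (φ a) = Algebra.lmul ℚ PolyXY (aeval xPoly a) := fun a => by
    have h : ρ.comp φ = (Algebra.lmul ℚ PolyXY).comp (aeval xPoly) :=
      algHom_ext fun d => by simp only [AlgHom.comp_apply, hφ, hρx, aeval_X]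
    exact congrArg (fun F => F a) h
  let Θ : MvPolynomial ℕ+ ℚ →ₐ[ℚ] Module.End ℚ PolyXY × PolyXY := (ρ.comp ψ).prod (aeval yPoly)
  have hΘX : ∀ d, Θ (X d) = yPair d := fun d =>
    Prod.ext ((congrArg ρ (hψ d)).trans (hρy d)) (aeval_X yPoly d)
  have hΘ : ∀ b, Θ b ∈ actsByMul := fun b => by
    induction b using MvPolynomial.induction_on with
    | C r =>
      rw [← algebraMap_eq, AlgHom.commutes]
      exact actsByMul.algebraMap_mem r
    | add p q hp hq =>
      rw [map_add]
      exact add_mem hp hq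
    | mul_X p d hp =>
      rw [map_mul, hΘX]
      exact mul_mem hp (yPair d).2
  have hρψ : ∀ b, ρ (ψ b) 1 = aeval yPoly b := fun b =>
    ((hΘ b).2 1 fun l => Derivation.map_one_eq_zero _).trans (mul_one _)
  have key : ∀ q, ρ (pEvalLin ℚ (sumFamily bx by') q) 1 = aeval (sumFamily xPoly yPoly) q := by
    intro q
    induction q using MvPolynomial.induction_on' with
    | add p q hp hq => rw [map_add, map_add, LinearMap.add_apply, hp, hq, map_add]
    | monomial e c =>
      have h : ∏ v ∈ e.support, sumFamily xPoly yPoly v ^ e v =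
          aeval xPoly (∏ v ∈ e.support, sumFamily (X (R := ℚ)) 1 v ^ e v) *
            aeval yPoly (∏ v ∈ e.support, sumFamily 1 (X (R := ℚ)) v ^ e v) := by
        rw [map_prod, map_prod, ← Finset.prod_mul_distrib]
        refine Finset.prod_congr rfl fun v _ => ?_
        induction v using Lex.rec with
        | _ v => cases v <;> simp
      rw [pEvalLin_monomial, ordProd_sumFamily hφ hψ, map_smul, map_mul, LinearMap.smul_apply,
        Module.End.mul_apply, hρψ, hρφ, aeval_monomial, ← Algebra.smul_def]
      exact congrArg (c • ·) h.symm
  exact fun p q h => aeval_sumFamily_injective (by rw [← key, ← key, h])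

end Representation

section Coefficients

variable {A : Type*} [Ring A] [Algebra ℚ A] {x y : ℕ+ → A}

lemma cEval_eq_pEvalLin (q : MvPolynomial (ℕ+ ⊕ₗ ℕ+) ℤ) : cEval x y q =
    pEvalLin ℚ (sumFamily x y) (MvPolynomial.map (algebraMap ℤ ℚ) q) := by
  rw [pEvalLin_map, pEvalLin_apply]
  rfl

lemma exists_cEval_eq_commutator
    (hx : ∀ k l, ghost x k * ghost x l = ghost x l * ghost x k)
    (hy : ∀ k l, ghost y k * ghost y l = ghost y l * ghost y k)
    (hyx : ∀ k l, ghost y l * ghost x k =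
      ghost x k * ghost y l + if k = l then ((k : ℕ) : A) else 0) (m n : ℕ+) :
    ∃ q, cEval x y q = y n * x m - x m * y n := by
  obtain ⟨φ, hφ⟩ := exists_algHom_of_commute ℤ x (commute_of_ghost_commute x hx)
  obtain ⟨ψ, hψ⟩ := exists_algHom_of_commute ℤ y (commute_of_ghost_commute y hy)
  have h := commutator_mem_integral hx hy hyx m n
  rw [← Set.image_univ, ← Set.image_univ] at h
  obtain ⟨q, -, hq⟩ := adjoin_mul_adjoin_le_map_supported hφ hψ (S := Set.univ)
    (fun _ _ => trivial) (fun _ _ => trivial) h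
  exact ⟨q, by rw [← hq, pEvalLin_apply]; rfl⟩

/-- The variables `X_d` and `Y_e` for proper divisors `d` of `m` and `e` of `n`. -/
def properVars (m n : ℕ+) : Set (ℕ+ ⊕ₗ ℕ+) :=
  {v | (∃ d : ℕ+, (d : ℕ) ∣ (m : ℕ) ∧ d ≠ m ∧ ofLex v = Sum.inl d) ∨
    (∃ e : ℕ+, (e : ℕ) ∣ (n : ℕ) ∧ e ≠ n ∧ ofLex v = Sum.inr e)}

lemma exists_mem_supported_pEvalLin_eq_commutator
    (hx : ∀ k l, ghost x k * ghost x l = ghost x l * ghost x k)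
    (hy : ∀ k l, ghost y k * ghost y l = ghost y l * ghost y k)
    (hyx : ∀ k l, ghost y l * ghost x k =
      ghost x k * ghost y l + if k = l then ((k : ℕ) : A) else 0) (m n : ℕ+) :
    ∃ r ∈ MvPolynomial.supported ℚ (properVars m n),
      pEvalLin ℚ (sumFamily x y) r = y n * x m - x m * y n := by
  obtain ⟨φ, hφ⟩ := exists_algHom_of_commute ℚ x (commute_of_ghost_commute x hx)
  obtain ⟨ψ, hψ⟩ := exists_algHom_of_commute ℚ y (commute_of_ghost_commute y hy)
  exact adjoin_mul_adjoin_le_map_supported hφ hψ (S := properVars m n)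
    (fun d hd => Or.inl ⟨d, hd.1, hd.2, rfl⟩) (fun e he => Or.inr ⟨e, he.1, he.2, rfl⟩)
    (commutator_mem_rational hyx m n)

end Coefficients

lemma cEval_injective : Function.Injective (cEval bx by') := fun p q h =>
  MvPolynomial.map_injective _ (algebraMap ℤ ℚ).injective_int
    (pEvalLin_injective (by rwa [← cEval_eq_pEvalLin, ← cEval_eq_pEvalLin]))

lemma cEval_one {A : Type*} [Ring A] [Algebra ℚ A] {x y : ℕ+ → A} : cEval x y 1 = 1 := by
  rw [cEval_eq_pEvalLin, map_one, ← MvPolynomial.C_1, MvPolynomial.C_apply, pEvalLin_monomial,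
    one_smul]
  simp [ordProd]

/-- For every `m, n ≥ 1` there is a unique polynomial `c_{m,n}` with integer coefficients
in the commuting variables `X_d` (`d` a proper divisor of `m`) and `Y_e` (`e` a proper
divisor of `n`) such that `[y_n, x_m] = c_{m,n}((x_d), (y_e))` holds in `B(ℚ)`; moreover
`c_{1,1} = 1`. -/
theorem cPoly_exists_unique :
    (∀ m n : ℕ+, ∃! q : MvPolynomial (ℕ+ ⊕ₗ ℕ+) ℤ,
      (∀ v ∈ q.vars,
        (∃ d : ℕ+, (d : ℕ) ∣ (m : ℕ) ∧ d ≠ m ∧ ofLex v = Sum.inl d) ∨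
        (∃ e : ℕ+, (e : ℕ) ∣ (n : ℕ) ∧ e ≠ n ∧ ofLex v = Sum.inr e)) ∧
      cEval bx by' q = by' n * bx m - bx m * by' n) ∧
    (∀ c : ℕ+ → ℕ+ → MvPolynomial (ℕ+ ⊕ₗ ℕ+) ℤ, IsCFamily c → c 1 1 = 1) := by
  refine ⟨fun m n => ?_, fun c hc => cEval_injective ?_⟩
  · obtain ⟨q, hq⟩ :=
      exists_cEval_eq_commutator ghost_bx_mul ghost_by'_mul ghost_by'_mul_ghost_bx m n
    obtain ⟨r, hr, hr'⟩ := exists_mem_supported_pEvalLin_eq_commutator ghost_bx_mul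
      ghost_by'_mul ghost_by'_mul_ghost_bx m n
    have hrq : r = MvPolynomial.map (algebraMap ℤ ℚ) q :=
      pEvalLin_injective (by rw [hr', ← cEval_eq_pEvalLin, hq])
    rw [hrq, MvPolynomial.mem_supported,
      MvPolynomial.vars_map_of_injective _ (algebraMap ℤ ℚ).injective_int] at hr
    exact ⟨q, ⟨fun v hv => hr hv, hq⟩, fun p hp => cEval_injective (hp.2.trans hq.symm)⟩
  · have h := ghost_by'_mul_ghost_bx 1 1
    rw [ghost_one, ghost_one, if_pos rfl, PNat.one_coe, Nat.cast_one] at h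
    rw [(hc 1 1).2, h, add_sub_cancel_left, cEval_one]

end
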